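/- Generalized Gronwall lemma: let T > 0, let v : [0,T] → ℝ be continuous and nonnegative, let a ≥ 0, and let b, m : [0,T] → ℝ be nonnegative integrable functions such that (1/2)·v(t)² ≤ (1/2)·a² + ∫₀ᵗ b(s)·v(s) ds + ∫₀ᵗ m(s)·v(s)² ds for every t ∈ [0,T]. Then v(t) ≤ ( a + ∫₀ᵗ b(s) ds )·exp( ∫₀ᵗ m(s) ds ) for every t ∈ [0,T]. -/

import Mathlib

open MeasureTheory intervalIntegral

open Set

/-- The composition of a Lipschitz function with an absolutely continuous function is absolutely
continuous. -/
theorem LipschitzOnWith.comp_absolutelyContinuousOnInterval {X Y : Type*} [PseudoMetricSpace X]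
    [PseudoMetricSpace Y] {g : X → Y} {f : ℝ → X} {K : NNReal} {a b : ℝ}
    (hg : LipschitzOnWith K g (f '' uIcc a b)) (hf : AbsolutelyContinuousOnInterval f a b) :
    AbsolutelyContinuousOnInterval (fun x ↦ g (f x)) a b := by
  rw [absolutelyContinuousOnInterval_iff] at hf ⊢
  intro ε hε
  obtain ⟨δ, hδ, h⟩ := hf (ε / (K + 1)) (by positivity)
  refine ⟨δ, hδ, fun E hE hlen ↦ ?_⟩
  calc
    _ ≤ ∑ i ∈ Finset.range E.1, K * dist (f (E.2 i).1) (f (E.2 i).2) :=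
      Finset.sum_le_sum fun i hi ↦ hg.dist_le_mul _ (mem_image_of_mem f (hE.1 i hi).1) _
        (mem_image_of_mem f (hE.1 i hi).2)
    _ = K * ∑ i ∈ Finset.range E.1, dist (f (E.2 i).1) (f (E.2 i).2) :=
      (Finset.mul_sum _ _ _).symm
    _ ≤ K * (ε / (K + 1)) := by gcongr; exact (h E hE hlen).le
    _ < (K + 1) * (ε / (K + 1)) := by gcongr; linarith
    _ = ε := by field

/-- The composition of a `C^1` function with a real-valued absolutely continuous function is
absolutely continuous. -/
theorem ContDiff.comp_absolutelyContinuousOnInterval {g f : ℝ → ℝ} {a b : ℝ}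
    (hg : ContDiff ℝ 1 g) (hf : AbsolutelyContinuousOnInterval f a b) :
    AbsolutelyContinuousOnInterval (fun x ↦ g (f x)) a b := by
  obtain ⟨R, hR⟩ := hf.exists_bound
  obtain ⟨K, hK⟩ := hg.contDiffOn.exists_lipschitzOnWith (s := Metric.closedBall 0 R)
    (by decide) (convex_closedBall 0 R) (isCompact_closedBall 0 R)
  refine (hK.mono ?_).comp_absolutelyContinuousOnInterval hf
  rintro _ ⟨x, hx, rfl⟩
  simpa using hR x hx

/-- The function `(c + ∫ b) * exp (∫ m)` occurring in the conclusion of Gronwall's lemma. -/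
noncomputable def gronwallMajorant (b m : ℝ → ℝ) (c t : ℝ) : ℝ :=
  (c + ∫ s in (0 : ℝ)..t, b s) * Real.exp (∫ s in (0 : ℝ)..t, m s)

theorem gronwallMajorant_zero (b m : ℝ → ℝ) (c : ℝ) : gronwallMajorant b m c 0 = c := by
  simp [gronwallMajorant]

theorem gronwallMajorant_nonneg {b m : ℝ → ℝ} {c t : ℝ} (hc : 0 ≤ c) (ht : 0 ≤ t)
    (hb : ∀ s ∈ Icc 0 t, 0 ≤ b s) : 0 ≤ gronwallMajorant b m c t :=
  mul_nonneg (add_nonneg hc (integral_nonneg ht hb)) (Real.exp_pos _).le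

theorem absolutelyContinuousOnInterval_gronwallMajorant {b m : ℝ → ℝ} {t : ℝ} (c : ℝ)
    (hb : IntervalIntegrable b volume 0 t) (hm : IntervalIntegrable m volume 0 t) :
    AbsolutelyContinuousOnInterval (gronwallMajorant b m c) 0 t := by
  have hB := (contDiff_const (c := c) |>.add contDiff_id).comp_absolutelyContinuousOnInterval
    (hb.absolutelyContinuousOnInterval_intervalIntegral left_mem_uIcc)
  have hM := Real.contDiff_exp.comp_absolutelyContinuousOnInterval
    (hm.absolutelyContinuousOnInterval_intervalIntegral left_mem_uIcc)
  exact hB.mul hM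

/-- The majorant is a supersolution of the quadratic integral equation. -/
theorem sq_add_integral_le_sq_gronwallMajorant {b m : ℝ → ℝ} {c t : ℝ} (hc : 0 ≤ c) (ht : 0 ≤ t)
    (hb_nonneg : ∀ s ∈ Icc 0 t, 0 ≤ b s) (hm_nonneg : ∀ s ∈ Icc 0 t, 0 ≤ m s)
    (hb : IntervalIntegrable b volume 0 t) (hm : IntervalIntegrable m volume 0 t) :
    c ^ 2 + 2 * ((∫ s in (0 : ℝ)..t, b s * gronwallMajorant b m c s) +
        ∫ s in (0 : ℝ)..t, m s * gronwallMajorant b m c s ^ 2) ≤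
      gronwallMajorant b m c t ^ 2 := by
  have hac := absolutelyContinuousOnInterval_gronwallMajorant c hb hm
  have hac2 := hac.fun_mul hac
  have hib := hb.mul_continuousOn hac.continuousOn
  have him := hm.mul_continuousOn (hac.continuousOn.fun_pow 2)
  have hle : (∫ s in (0 : ℝ)..t, 2 * (b s * gronwallMajorant b m c s +
      m s * gronwallMajorant b m c s ^ 2)) ≤
      ∫ s in (0 : ℝ)..t, deriv (fun s ↦ gronwallMajorant b m c s * gronwallMajorant b m c s) s := by
    refine integral_mono_ae_restrict ht ((hib.add him).const_mul 2)
      hac2.intervalIntegrable_deriv ?_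
    filter_upwards [ae_restrict_of_ae hb.ae_hasDerivAt_integral,
      ae_restrict_of_ae hm.ae_hasDerivAt_integral, ae_restrict_mem measurableSet_Icc]
      with s hbs hms hs
    have hs' : s ∈ uIcc 0 t := by rwa [uIcc_of_le ht]
    have hsub : Icc 0 s ⊆ Icc 0 t := Icc_subset_Icc_right hs.2
    have hd : HasDerivAt (gronwallMajorant b m c)
        (b s * Real.exp (∫ u in (0 : ℝ)..s, m u) + (c + ∫ u in (0 : ℝ)..s, b u) *
          (Real.exp (∫ u in (0 : ℝ)..s, m u) * m s)) s :=
      ((hbs hs' 0 left_mem_uIcc).const_add c).mul (hms hs' 0 left_mem_uIcc).exp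
    have hψ : 0 ≤ gronwallMajorant b m c s :=
      gronwallMajorant_nonneg hc hs.1 fun u hu ↦ hb_nonneg u (hsub hu)
    have hE : 1 ≤ Real.exp (∫ u in (0 : ℝ)..s, m u) :=
      Real.one_le_exp (integral_nonneg hs.1 fun u hu ↦ hm_nonneg u (hsub hu))
    have hbψ := mul_le_mul_of_nonneg_left hE (mul_nonneg (hb_nonneg s hs) hψ)
    have hdef : gronwallMajorant b m c s =
      (c + ∫ u in (0 : ℝ)..s, b u) * Real.exp (∫ u in (0 : ℝ)..s, m u) := rfl
    rw [(hd.fun_mul hd).deriv]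
    linear_combination 2 * hbψ + 2 * m s * gronwallMajorant b m c s * hdef
  rw [hac2.integral_deriv_eq_sub, intervalIntegral.integral_const_mul,
    intervalIntegral.integral_add hib him,
    gronwallMajorant_zero] at hle
  linarith

/-- A strict form of Gronwall's lemma: a strictly larger initial constant gives a strict bound. -/
theorem lt_gronwallMajorant {T : ℝ} {v b m : ℝ → ℝ} {a c : ℝ} (ha : 0 ≤ a) (hac : a < c)
    (hv_cont : ContinuousOn v (Icc 0 T)) (hv_nonneg : ∀ t ∈ Icc (0 : ℝ) T, 0 ≤ v t)
    (hb_nonneg : ∀ t ∈ Icc (0 : ℝ) T, 0 ≤ b t) (hm_nonneg : ∀ t ∈ Icc (0 : ℝ) T, 0 ≤ m t)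
    (hb_int : IntervalIntegrable b volume 0 T) (hm_int : IntervalIntegrable m volume 0 T)
    (hineq : ∀ t ∈ Icc (0 : ℝ) T, (1 / 2) * v t ^ 2 ≤ (1 / 2) * a ^ 2 +
        (∫ s in (0 : ℝ)..t, b s * v s) + ∫ s in (0 : ℝ)..t, m s * v s ^ 2) :
    ∀ t ∈ Icc (0 : ℝ) T, v t < gronwallMajorant b m c t := by
  by_contra! hcon
  obtain ⟨t₁, ht₁, hvt₁⟩ := hcon
  have hT : 0 ≤ T := ht₁.1.trans ht₁.2
  have hc : 0 ≤ c := ha.trans hac.le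
  have hψ_cont : ContinuousOn (gronwallMajorant b m c) (Icc 0 T) := by
    simpa [uIcc_of_le hT] using
      (absolutelyContinuousOnInterval_gronwallMajorant c hb_int hm_int).continuousOn
  have hcompact : IsCompact {t ∈ Icc (0 : ℝ) T | gronwallMajorant b m c t ≤ v t} :=
    isCompact_Icc.of_isClosed_subset (isClosed_Icc.isClosed_le hψ_cont hv_cont) (sep_subset _ _)
  obtain ⟨t, ⟨ht, hvt⟩, hmin⟩ := hcompact.exists_isLeast ⟨t₁, ht₁, hvt₁⟩
  have hsub : Icc 0 t ⊆ Icc 0 T := Icc_subset_Icc_right ht.2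
  have husub : uIcc 0 t ⊆ uIcc 0 T := by rwa [uIcc_of_le ht.1, uIcc_of_le hT]
  have husub' : uIcc 0 t ⊆ Icc 0 T := by rwa [uIcc_of_le ht.1]
  have hlt : ∀ s ∈ Ioo 0 t, v s ≤ gronwallMajorant b m c s := fun s hs ↦ by
    by_contra! h
    exact hs.2.not_ge (hmin ⟨hsub (Ioo_subset_Icc_self hs), h.le⟩)
  have hb := hb_int.mono_set husub
  have hm := hm_int.mono_set husub
  have hv := hv_cont.mono husub'
  have hψ := hψ_cont.mono husub'
  have hbv : (∫ s in (0 : ℝ)..t, b s * v s) ≤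
      ∫ s in (0 : ℝ)..t, b s * gronwallMajorant b m c s :=
    integral_mono_on_of_le_Ioo ht.1 (hb.mul_continuousOn hv) (hb.mul_continuousOn hψ)
      fun s hs ↦ mul_le_mul_of_nonneg_left (hlt s hs) (hb_nonneg s (hsub (Ioo_subset_Icc_self hs)))
  have hmv : (∫ s in (0 : ℝ)..t, m s * v s ^ 2) ≤
      ∫ s in (0 : ℝ)..t, m s * gronwallMajorant b m c s ^ 2 :=
    integral_mono_on_of_le_Ioo ht.1 (hm.mul_continuousOn (hv.pow 2))
      (hm.mul_continuousOn (hψ.pow 2)) fun s hs ↦ by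
        have hs' := hsub (Ioo_subset_Icc_self hs)
        exact mul_le_mul_of_nonneg_left (pow_le_pow_left₀ (hv_nonneg s hs') (hlt s hs) 2)
          (hm_nonneg s hs')
  have hsuper := sq_add_integral_le_sq_gronwallMajorant hc ht.1
    (fun s hs ↦ hb_nonneg s (hsub hs)) (fun s hs ↦ hm_nonneg s (hsub hs)) hb hm
  have hsq := pow_le_pow_left₀
    (gronwallMajorant_nonneg (m := m) hc ht.1 fun s hs ↦ hb_nonneg s (hsub hs)) hvt 2
  have hac2 := pow_lt_pow_left₀ hac ha two_ne_zero
  linarith [hineq t ht]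

/-- Generalized Gronwall lemma (Baiocchi): if `v : [0,T] → ℝ` is continuous and
nonnegative, `a ≥ 0`, `b, m` are nonnegative integrable functions on `[0,T]`, and
`(1/2) v(t)² ≤ (1/2) a² + ∫₀ᵗ b v + ∫₀ᵗ m v²` for every `t ∈ [0,T]`, then
`v(t) ≤ (a + ∫₀ᵗ b) exp(∫₀ᵗ m)` for every `t ∈ [0,T]`. -/
theorem stmt13 {T : ℝ} (hT : 0 < T) (v b m : ℝ → ℝ) (a : ℝ) (ha : 0 ≤ a)
    (hv_cont : ContinuousOn v (Set.Icc 0 T))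
    (hv_nonneg : ∀ t ∈ Set.Icc (0 : ℝ) T, 0 ≤ v t)
    (hb_nonneg : ∀ t ∈ Set.Icc (0 : ℝ) T, 0 ≤ b t)
    (hm_nonneg : ∀ t ∈ Set.Icc (0 : ℝ) T, 0 ≤ m t)
    (hb_int : IntervalIntegrable b volume 0 T)
    (hm_int : IntervalIntegrable m volume 0 T)
    (hineq : ∀ t ∈ Set.Icc (0 : ℝ) T,
      (1 / 2) * v t ^ 2 ≤ (1 / 2) * a ^ 2 +
        (∫ s in (0 : ℝ)..t, b s * v s) + ∫ s in (0 : ℝ)..t, m s * v s ^ 2) :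
    ∀ t ∈ Set.Icc (0 : ℝ) T,
      v t ≤ (a + ∫ s in (0 : ℝ)..t, b s) * Real.exp (∫ s in (0 : ℝ)..t, m s) := by
  intro t ht
  refine ge_of_tendsto (f := fun c ↦ gronwallMajorant b m c t) (x := nhdsWithin a (Ioi a)) ?_ ?_
  · exact ((continuous_id.add continuous_const).mul continuous_const).continuousWithinAt
  · filter_upwards [self_mem_nhdsWithin] with c hc
    exact (lt_gronwallMajorant ha hc hv_cont hv_nonneg hb_nonneg hm_nonneg hb_int hm_int hineq
      t ht).le
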